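/- arXiv:1110.5977 — 5 statements merged into one kernel-verified Lean document; each statement's English description precedes it below -/
import Mathlib

section
/- Let M be a vertex-transitive map in which every vertex has degree q, and suppose M is a k-orbit map. Then k divides 2q. -/
/-- A map: a finite nonempty set of flags with three fixed-point-free involutions
`s0, s1, s2` such that `s0 * s2` is also a fixed-point-free involution and the
group generated by them acts transitively on the flags. -/
structure CMap (F : Type) [Fintype F] where
  nonempty : Nonempty F
  s0 : Equiv.Perm F
  s1 : Equiv.Perm F
  s2 : Equiv.Perm F
  invol0 : s0 * s0 = 1
  invol1 : s1 * s1 = 1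
  invol2 : s2 * s2 = 1
  fpf0 : ∀ x, s0 x ≠ x
  fpf1 : ∀ x, s1 x ≠ x
  fpf2 : ∀ x, s2 x ≠ x
  invol02 : (s0 * s2) * (s0 * s2) = 1
  fpf02 : ∀ x, s0 (s2 x) ≠ x
  conn : ∀ x y : F, ∃ g ∈ Subgroup.closure ({s0, s1, s2} : Set (Equiv.Perm F)), g x = y

namespace CMap

variable {F : Type} [Fintype F]

/-- The automorphism group of a map: all permutations of the flags commuting
with each of `s0, s1, s2`. -/
def aut (M : CMap F) : Subgroup (Equiv.Perm F) :=
  Subgroup.centralizer {M.s0, M.s1, M.s2}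

/-- The vertex containing a flag `x`: the orbit of `x` under `⟨s1, s2⟩`. -/
def vertexOf (M : CMap F) (x : F) : Set F :=
  MulAction.orbit (Subgroup.closure ({M.s1, M.s2} : Set (Equiv.Perm F))) x

/-- The edge containing a flag `x`: the orbit of `x` under `⟨s0, s2⟩`. -/
def edgeOf (M : CMap F) (x : F) : Set F :=
  MulAction.orbit (Subgroup.closure ({M.s0, M.s2} : Set (Equiv.Perm F))) x

/-- The face containing a flag `x`: the orbit of `x` under `⟨s0, s1⟩`. -/
def faceOf (M : CMap F) (x : F) : Set F :=
  MulAction.orbit (Subgroup.closure ({M.s0, M.s1} : Set (Equiv.Perm F))) x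

/-- The orbit of a flag under the automorphism group. -/
def flagOrbit (M : CMap F) (x : F) : Set F :=
  MulAction.orbit M.aut x

noncomputable def numVertices (M : CMap F) : ℕ := Nat.card (Set.range M.vertexOf)

noncomputable def numEdges (M : CMap F) : ℕ := Nat.card (Set.range M.edgeOf)

noncomputable def numFaces (M : CMap F) : ℕ := Nat.card (Set.range M.faceOf)

/-- The Euler characteristic `V - E + F` of a map. -/
noncomputable def euler (M : CMap F) : ℤ :=
  (M.numVertices : ℤ) - (M.numEdges : ℤ) + (M.numFaces : ℤ)

/-- The number of orbits of the automorphism group on flags. -/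
noncomputable def numFlagOrbits (M : CMap F) : ℕ := Nat.card (Set.range M.flagOrbit)

/-- `M` is a `k`-orbit map if its automorphism group has exactly `k` orbits on flags. -/
def IsKOrbit (M : CMap F) (k : ℕ) : Prop := M.numFlagOrbits = k

/-- A map is regular if it is a 1-orbit map. -/
def IsRegular (M : CMap F) : Prop := M.IsKOrbit 1

/-- A map is chiral if it is a 2-orbit map in which every flag lies in a
different automorphism orbit from each of its images under `s0, s1, s2`. -/
def IsChiral (M : CMap F) : Prop :=
  M.IsKOrbit 2 ∧ ∀ x : F,
    M.s0 x ∉ M.flagOrbit x ∧ M.s1 x ∉ M.flagOrbit x ∧ M.s2 x ∉ M.flagOrbit x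

/-- A map is vertex-transitive if its automorphism group acts transitively on vertices. -/
def VertexTransitive (M : CMap F) : Prop :=
  ∀ x y : F, ∃ g ∈ M.aut, M.vertexOf (g x) = M.vertexOf y

/-- A map is edge-transitive if its automorphism group acts transitively on edges. -/
def EdgeTransitive (M : CMap F) : Prop :=
  ∀ x y : F, ∃ g ∈ M.aut, M.edgeOf (g x) = M.edgeOf y

/-- `M` is equivelar of Schläfli type `{p, q}`: every face has exactly `2p` flags
and every vertex has exactly `2q` flags. -/
def Equivelar (M : CMap F) (p q : ℕ) : Prop :=
  (∀ x : F, Nat.card (M.faceOf x) = 2 * p) ∧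
  (∀ x : F, Nat.card (M.vertexOf x) = 2 * q)

/-- A map is orientable if the flags can be partitioned into two classes so that
each of `s0, s1, s2` maps each class into the other. -/
def Orientable (M : CMap F) : Prop :=
  ∃ A : Set F,
    (∀ x, M.s0 x ∈ A ↔ x ∉ A) ∧ (∀ x, M.s1 x ∈ A ↔ x ∉ A) ∧ (∀ x, M.s2 x ∈ A ↔ x ∉ A)

end CMap

/-- Two maps are isomorphic if there is a bijection between their flag sets
commuting with the respective involutions. -/
def CMap.Isomorphic {F F' : Type} [Fintype F] [Fintype F'] (M : CMap F) (N : CMap F') : Prop :=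
  ∃ e : F ≃ F',
    (∀ x, e (M.s0 x) = N.s0 (e x)) ∧ (∀ x, e (M.s1 x) = N.s1 (e x)) ∧
    (∀ x, e (M.s2 x) = N.s2 (e x))

namespace CMap

variable {F : Type}

theorem apply_comm_of_mem_closure {S : Set (Equiv.Perm F)} {g h : Equiv.Perm F}
    (hg : g ∈ Subgroup.centralizer S) (hh : h ∈ Subgroup.closure S) (x : F) :
    g (h x) = h (g x) := by
  have hcomm : h * g = g * h := by
    rw [← Subgroup.centralizer_closure] at hg
    exact Subgroup.mem_centralizer_iff.mp hg h hh
  exact (Equiv.Perm.congr_fun hcomm x).symm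

variable [Fintype F]

/-- The automorphism group of a map acts freely on its flags. -/
theorem eq_of_apply_eq (M : CMap F) {g g' : Equiv.Perm F} (hg : g ∈ M.aut) (hg' : g' ∈ M.aut)
    {x : F} (hx : g x = g' x) : g = g' := by
  ext y
  obtain ⟨h, hh, rfl⟩ := M.conn x y
  rw [apply_comm_of_mem_closure hg hh, apply_comm_of_mem_closure hg' hh, hx]

theorem mem_vertexOf_iff (M : CMap F) {x y : F} :
    y ∈ M.vertexOf x ↔
      ∃ h ∈ Subgroup.closure ({M.s1, M.s2} : Set (Equiv.Perm F)), h x = y := by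
  simp [vertexOf, MulAction.mem_orbit_iff, Subgroup.smul_def]

theorem mem_flagOrbit_iff (M : CMap F) {x y : F} :
    y ∈ M.flagOrbit x ↔ ∃ g ∈ M.aut, g x = y := by
  simp [flagOrbit, MulAction.mem_orbit_iff, Subgroup.smul_def]

theorem flagOrbit_eq_iff (M : CMap F) {x y : F} :
    M.flagOrbit x = M.flagOrbit y ↔ x ∈ M.flagOrbit y :=
  MulAction.orbit_eq_iff

theorem vertexOf_eq_iff (M : CMap F) {x y : F} :
    M.vertexOf x = M.vertexOf y ↔ x ∈ M.vertexOf y :=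
  MulAction.orbit_eq_iff

theorem apply_mem_vertexOf_apply (M : CMap F) {g : Equiv.Perm F} (hg : g ∈ M.aut) {x y : F}
    (hy : y ∈ M.vertexOf x) : g y ∈ M.vertexOf (g x) := by
  obtain ⟨h, hh, rfl⟩ := M.mem_vertexOf_iff.mp hy
  refine M.mem_vertexOf_iff.mpr ⟨h, hh, (apply_comm_of_mem_closure hg ?_ x).symm⟩
  exact Subgroup.closure_mono (Set.subset_insert _ _) hh

/-- The orbit of a flag at a vertex contains as many flags at that vertex as there are
automorphisms fixing the vertex. -/
theorem card_flagOrbit_inter_vertexOf (M : CMap F) {x y : F} (hy : y ∈ M.vertexOf x) :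
    Nat.card {z : M.vertexOf x // M.flagOrbit z = M.flagOrbit y} =
      Nat.card {g : Equiv.Perm F // g ∈ M.aut ∧ g x ∈ M.vertexOf x} := by
  have hfix {g : Equiv.Perm F} (hg : g ∈ M.aut) : g y ∈ M.vertexOf x ↔ g x ∈ M.vertexOf x := by
    rw [← M.vertexOf_eq_iff, ← M.vertexOf_eq_iff,
      M.vertexOf_eq_iff.mpr (M.apply_mem_vertexOf_apply hg hy)]
  symm
  refine Nat.card_congr (Equiv.ofBijective
    (fun g => ⟨⟨g.1 y, (hfix g.2.1).mpr g.2.2⟩,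
      M.flagOrbit_eq_iff.mpr (M.mem_flagOrbit_iff.mpr ⟨g.1, g.2.1, rfl⟩)⟩) ⟨?_, ?_⟩)
  · intro g g' h
    simp only [Subtype.mk.injEq] at h
    exact Subtype.ext (M.eq_of_apply_eq g.2.1 g'.2.1 h)
  · rintro ⟨⟨z, hz⟩, hzy⟩
    obtain ⟨g, hg, rfl⟩ := M.mem_flagOrbit_iff.mp (M.flagOrbit_eq_iff.mp hzy)
    exact ⟨⟨g, hg, (hfix hg).mp hz⟩, rfl⟩

/-- In a vertex-transitive map, every flag orbit meets every vertex. -/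
theorem VertexTransitive.exists_mem_vertexOf {M : CMap F} (hM : M.VertexTransitive) (x y : F) :
    ∃ z ∈ M.vertexOf x, M.flagOrbit z = M.flagOrbit y := by
  obtain ⟨g, hg, h⟩ := hM y x
  exact ⟨g y, M.vertexOf_eq_iff.mp h,
    M.flagOrbit_eq_iff.mpr (M.mem_flagOrbit_iff.mpr ⟨g, hg, rfl⟩)⟩

/-- In a vertex-transitive map, the number of flags at a vertex is the number of flag orbits times
the number of automorphisms fixing the vertex. -/
theorem VertexTransitive.card_vertexOf {M : CMap F} (hM : M.VertexTransitive) (x : F) :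
    Nat.card (M.vertexOf x) =
      M.numFlagOrbits * Nat.card {g : Equiv.Perm F // g ∈ M.aut ∧ g x ∈ M.vertexOf x} := by
  let f : M.vertexOf x → Set.range M.flagOrbit := fun z => ⟨M.flagOrbit z, z, rfl⟩
  have hfiber (o : Set.range M.flagOrbit) : Nat.card {z // f z = o} =
      Nat.card {g : Equiv.Perm F // g ∈ M.aut ∧ g x ∈ M.vertexOf x} := by
    obtain ⟨_, y, rfl⟩ := o
    obtain ⟨z, hz, hzy⟩ := hM.exists_mem_vertexOf x y
    rw [← M.card_flagOrbit_inter_vertexOf hz]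
    exact Nat.card_congr (Equiv.subtypeEquivRight fun w => by
      simpa only [f, hzy] using Subtype.ext_iff)
  have : Fintype (Set.range M.flagOrbit) := Fintype.ofFinite _
  rw [← Nat.card_congr (Equiv.sigmaFiberEquiv f), Nat.card_sigma]
  simp only [hfiber, Finset.sum_const, Finset.card_univ, smul_eq_mul, numFlagOrbits,
    Nat.card_eq_fintype_card (α := Set.range M.flagOrbit)]

end CMap

/-- For a vertex-transitive `k`-orbit map all of whose vertices
have degree `q`, `k` divides `2q`. -/
theorem stmt_0 {F : Type} [Fintype F] (M : CMap F) (q k : ℕ)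
    (hdeg : ∀ x : F, Nat.card (M.vertexOf x) = 2 * q)
    (hvt : M.VertexTransitive) (hk : M.IsKOrbit k) :
    k ∣ 2 * q := by
  obtain ⟨x⟩ := M.nonempty
  rw [← hdeg x, hvt.card_vertexOf x, hk]
  exact dvd_mul_right _ _
end

section
/- Let p be a positive integer congruent to 1 or 5 modulo 6. Then every vertex-transitive equivelar map of Schläfli type {p,3} is either regular or chiral. -/
open Equiv (Perm) in
/-- A set preserved by involutions generating a group is preserved by the whole group. -/
theorem apply_mem_of_mem_closure_of_involutive {α : Type*} {K : Set (Perm α)}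
    {S : Set α} (hK : ∀ k ∈ K, k * k = 1) (hS : ∀ k ∈ K, ∀ x ∈ S, k x ∈ S)
    {g : Perm α} (hg : g ∈ Subgroup.closure K) {x : α} (hx : x ∈ S) : g x ∈ S := by
  suffices h : ∀ y, g y ∈ S ↔ y ∈ S from (h x).2 hx
  clear hx x
  induction hg using Subgroup.closure_induction with
  | mem k hk =>
    refine fun y => ⟨fun h => ?_, hS k hk y⟩
    have := hS k hk _ h
    rwa [← Perm.mul_apply, hK k hk] at this
  | one => simp
  | mul g h _ _ ihg ihh => exact fun y => by rw [Perm.mul_apply, ihg, ihh]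
  | inv g _ ih => exact fun y => by rw [← ih, ← Perm.mul_apply, mul_inv_cancel, Perm.one_apply]

open Equiv (Perm) in
/-- Two fixed-point-free involutions `a`, `b` generate a dihedral group each of whose orbits
of size `2 * n` splits into two cycles of length `n` of `a * b`. -/
theorem pow_mul_apply_eq_self_of_card_orbit {α : Type*} [Finite α] {a b : Perm α}
    (ha : a * a = 1) (hb : b * b = 1) (hfa : ∀ x, a x ≠ x) (hfb : ∀ x, b x ≠ x) {n : ℕ} {x : α}
    (hx : Nat.card (MulAction.orbit (Subgroup.closure {a, b}) x) = 2 * n) :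
    ((a * b) ^ n) x = x := by
  set r := a * b with hr
  have har : ∀ k : ℤ, a * r ^ k = r ^ (-k) * a := by
    intro k
    have h : a * r * a⁻¹ = r⁻¹ := by
      rw [hr, mul_inv_rev, inv_eq_of_mul_eq_one_left ha, inv_eq_of_mul_eq_one_left hb,
        ← mul_assoc, ha, one_mul]
    rw [zpow_neg, ← inv_zpow, ← h, conj_zpow, inv_mul_cancel_right]
  have hbr : b = a * r := by rw [hr, ← mul_assoc, ha, one_mul]
  set C : Set α := MulAction.orbit (Subgroup.zpowers r) x with hC
  have memC : ∀ y, y ∈ C ↔ ∃ k : ℤ, (r ^ k) x = y := by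
    intro y
    constructor
    · rintro ⟨⟨_, k, rfl⟩, rfl⟩
      exact ⟨k, rfl⟩
    · rintro ⟨k, rfl⟩
      exact ⟨⟨_, k, rfl⟩, rfl⟩
  have harx : ∀ (k : ℤ) (y : α), a ((r ^ k) y) = (r ^ (-k)) (a y) := fun k y => by
    rw [← Perm.mul_apply, har, Perm.mul_apply]
  have haa : ∀ y, a (a y) = y := fun y => by rw [← Perm.mul_apply, ha, Perm.one_apply]
  have hax : ∀ k : ℤ, a x ≠ (r ^ k) x := by
    intro k hk
    obtain ⟨j, rfl | rfl⟩ := Int.even_or_odd' k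
    · refine hfa ((r ^ j) x) ?_
      rw [harx, hk, ← Perm.mul_apply, ← zpow_add]
      congr 2
      ring
    · refine hfb ((r ^ j) x) ?_
      rw [hbr, Perm.mul_apply, ← Perm.mul_apply r, ← zpow_one_add, harx, hk, ← Perm.mul_apply,
        ← zpow_add]
      congr 2
      ring
  have hdisj : Disjoint C (a '' C) := by
    rw [Set.disjoint_left]
    rintro y hy ⟨z, hz, rfl⟩
    obtain ⟨k, hk⟩ := (memC _).1 hy
    obtain ⟨l, rfl⟩ := (memC _).1 hz
    rw [harx] at hk
    refine hax (l + k) ?_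
    rw [zpow_add, Perm.mul_apply, hk, ← Perm.mul_apply, ← zpow_add, add_neg_cancel, zpow_zero,
      Perm.one_apply]
  have horb : MulAction.orbit (Subgroup.closure {a, b}) x = C ∪ a '' C := by
    apply Set.Subset.antisymm
    · rintro _ ⟨⟨g, hg⟩, rfl⟩
      have hstep_a : ∀ y ∈ C ∪ a '' C, a y ∈ C ∪ a '' C := by
        rintro y (hy | ⟨z, hz, rfl⟩)
        · exact Or.inr ⟨y, hy, rfl⟩
        · exact Or.inl (by rwa [haa])
      have hstep_r : ∀ y ∈ C ∪ a '' C, r y ∈ C ∪ a '' C := by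
        rintro y (hy | ⟨z, hz, rfl⟩)
        · obtain ⟨k, rfl⟩ := (memC _).1 hy
          exact Or.inl ((memC _).2 ⟨1 + k, by rw [zpow_one_add, Perm.mul_apply]⟩)
        · obtain ⟨k, rfl⟩ := (memC _).1 hz
          refine Or.inr ⟨(r ^ (-1 + k)) x, (memC _).2 ⟨_, rfl⟩, ?_⟩
          rw [zpow_add, Perm.mul_apply, harx, neg_neg, zpow_one]
      refine apply_mem_of_mem_closure_of_involutive (S := C ∪ a '' C) ?_ ?_ hg
        (Or.inl ((memC _).2 ⟨0, rfl⟩))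
      · rintro k (rfl | rfl) <;> assumption
      · rintro k (rfl | rfl)
        · exact hstep_a
        · intro y hy
          rw [hbr]
          exact hstep_a _ (hstep_r _ hy)
    · have ma : a ∈ Subgroup.closure {a, b} := Subgroup.subset_closure (by simp)
      have mb : b ∈ Subgroup.closure {a, b} := Subgroup.subset_closure (by simp)
      have mr : ∀ k : ℤ, r ^ k ∈ Subgroup.closure {a, b} := fun k =>
        Subgroup.zpow_mem _ (Subgroup.mul_mem _ ma mb) k
      rintro y (hy | ⟨z, hz, rfl⟩)
      · obtain ⟨k, rfl⟩ := (memC _).1 hy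
        exact ⟨⟨_, mr k⟩, rfl⟩
      · obtain ⟨k, rfl⟩ := (memC _).1 hz
        exact ⟨⟨_, Subgroup.mul_mem _ ma (mr k)⟩, rfl⟩
  have hcard : C.ncard = n := by
    have h : (C ∪ a '' C).ncard = 2 * n := by rw [← hx, ← horb]; rfl
    rw [Set.ncard_union_eq hdisj, Set.ncard_image_of_injective _ a.injective] at h
    lia
  have hper : Function.minimalPeriod (r • ·) x = n := by
    rw [← hcard]
    exact (Nat.card_congr (MulAction.orbitZPowersEquiv r x)).trans (Nat.card_zmod _) |>.symm
  have h := MulAction.pow_smul_eq_iff_minimalPeriod_dvd (a := r) (b := x) (n := n)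
  exact h.2 hper.dvd

open Equiv (Perm) in
/-- On at most six points, if `⟨a₁, a₂⟩` is a transitive quotient of `S₃`, `a₀` is an involution
commuting with `a₂`, and `a₀ * a₁` has order prime to `6`, then `a₀ = a₁ = a₂`. -/
theorem eq_of_transitive_of_mul_pow_eq_one {X : Type*} [Finite X] {a₀ a₁ a₂ : Perm X}
    (h₀ : a₀ * a₀ = 1) (h₁ : a₁ * a₁ = 1) (h₂ : a₂ * a₂ = 1) (h₀₂ : a₀ * a₂ = a₂ * a₀)
    (h₁₂ : (a₁ * a₂) ^ 3 = 1) {p : ℕ} (hp : p % 6 = 1 ∨ p % 6 = 5) (h₀₁ : (a₀ * a₁) ^ p = 1)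
    (hX : Nat.card X ≤ 6)
    (htrans : ∀ S : Set X, S.Nonempty → (∀ x ∈ S, a₁ x ∈ S) → (∀ x ∈ S, a₂ x ∈ S) →
      S = Set.univ) :
    a₀ = a₁ ∧ a₁ = a₂ := by
  classical
  have := Fintype.ofFinite X
  have e₁ : ∀ x, a₁ (a₁ x) = x := fun x => by rw [← Perm.mul_apply, h₁, Perm.one_apply]
  have e₂ : ∀ x, a₂ (a₂ x) = x := fun x => by rw [← Perm.mul_apply, h₂, Perm.one_apply]
  have e₁₂ : ∀ x, a₁ (a₂ (a₁ (a₂ (a₁ (a₂ x))))) = x := fun x => by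
    simpa [pow_succ] using congrArg (fun f : Perm X => f x) h₁₂
  have hfix : ∀ y, a₁ y = y → Fintype.card X ≤ 3 := by
    intro y hy
    have hS : ({y, a₂ y, a₁ (a₂ y)} : Set X) = Set.univ := by
      refine htrans _ ⟨y, by simp⟩ ?_ ?_
      · rintro x (rfl | rfl | rfl) <;> simp [hy, e₁]
      · rintro x (rfl | rfl | rfl)
        · simp
        · simp [e₂]
        · have h := e₁₂ y
          have h' : a₂ (a₁ (a₂ y)) = a₁ (a₂ y) := by
            rw [← e₁ (a₂ (a₁ (a₂ y))), ← e₂ (a₁ (a₂ (a₁ (a₂ y)))),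
              ← e₁ (a₂ (a₁ (a₂ (a₁ (a₂ y))))), h, hy]
          simp [h']
    rw [← Nat.card_eq_fintype_card, ← Set.ncard_univ, ← hS]
    have c₁ := Set.ncard_insert_le y {a₂ y, a₁ (a₂ y)}
    have c₂ := Set.ncard_insert_le (a₂ y) {a₁ (a₂ y)}
    rw [Set.ncard_singleton] at c₂
    lia
  have hr5 : (a₀ * a₁) ^ 5 = 1 := by
    rw [← orderOf_dvd_iff_pow_eq_one]
    have d1 : orderOf (a₀ * a₁) ∣ p := orderOf_dvd_of_pow_eq_one h₀₁
    have d2 : orderOf (a₀ * a₁) ∣ 144 * 5 := by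
      refine (orderOf_dvd_card (x := a₀ * a₁)).trans ?_
      rw [Fintype.card_perm, ← Nat.card_eq_fintype_card]
      exact Nat.factorial_dvd_factorial hX
    have c2 : Nat.Coprime p 2 := ((Nat.Prime.coprime_iff_not_dvd Nat.prime_two).2 (by lia)).symm
    have c3 : Nat.Coprime p 3 :=
      ((Nat.Prime.coprime_iff_not_dvd Nat.prime_three).2 (by lia)).symm
    have c : Nat.Coprime p 144 := by
      have := (c2.pow_right 4).mul_right (c3.pow_right 2)
      simpa using this
    exact (c.coprime_dvd_left d1).dvd_of_dvd_mul_left d2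
  have hr : a₀ * a₁ = 1 := by
    by_contra hne
    have : Fact (Nat.Prime 5) := ⟨Nat.prime_five⟩
    have hmod := Equiv.Perm.card_fixedPoints_modEq (p := 5) (n := 1) (f := ⇑(a₀ * a₁))
      (by funext x; exact Perm.ext_iff.1 hr5 x)
    have hmod₁ := Equiv.Perm.card_fixedPoints_modEq (p := 2) (n := 1) (f := ⇑a₁)
      (by funext x; exact e₁ x)
    have hlt : Fintype.card (Function.fixedPoints ⇑(a₀ * a₁)) < Fintype.card X := by
      obtain ⟨x, hx⟩ : ∃ x, (a₀ * a₁) x ≠ x := by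
        by_contra! h
        exact hne (Perm.ext h)
      exact Fintype.card_subtype_lt (p := (· ∈ Function.fixedPoints ⇑(a₀ * a₁))) hx
    rw [Nat.card_eq_fintype_card] at hX
    simp only [Nat.ModEq] at hmod hmod₁
    have hnofix : Fintype.card (Function.fixedPoints ⇑a₁) = 0 := by
      rw [Fintype.card_eq_zero_iff]
      refine ⟨fun ⟨y, hy⟩ => ?_⟩
      have := hfix y hy
      lia
    obtain ⟨⟨z, hz⟩, huniq⟩ := Fintype.card_eq_one_iff.1
      (show Fintype.card (Function.fixedPoints ⇑(a₀ * a₁)) = 1 by lia)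
    have hz' : a₁ z = a₀ z := by
      have h : a₀ (a₁ z) = z := hz
      have h' : a₀ (a₀ (a₁ z)) = a₁ z := by rw [← Perm.mul_apply, h₀, Perm.one_apply]
      rw [← h', h]
    have hz₁ : a₁ z = z := congrArg Subtype.val (huniq ⟨a₁ z, by
      change a₀ (a₁ (a₁ z)) = a₁ z
      rw [e₁, hz']⟩)
    exact (Fintype.card_eq_zero_iff.1 hnofix).false ⟨z, hz₁⟩
  have h01 : a₀ = a₁ := by
    rw [← mul_one a₀, ← h₁, ← mul_assoc, hr, one_mul]
  refine ⟨h01, ?_⟩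
  subst h01
  have h2 : (a₀ * a₂) * (a₀ * a₂) = 1 := by
    nth_rw 2 [h₀₂]
    rw [mul_assoc, ← mul_assoc a₂, h₂, one_mul, h₁]
  have h3 : a₀ * a₂ = 1 := by
    rwa [pow_succ, sq, h2, one_mul] at h₁₂
  rw [← mul_one a₀, ← h₂, ← mul_assoc, h3, one_mul]

namespace CMap

variable {F : Type} [Fintype F] (M : CMap F)

/-- The involution induced on the flag orbits by an involution commuting with every
automorphism. -/
def orbitPerm (s : Equiv.Perm F) (hs : s * s = 1) (hc : ∀ g ∈ M.aut, s * g = g * s) :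
    Equiv.Perm (MulAction.orbitRel.Quotient M.aut F) :=
  Function.Involutive.toPerm
    (Quotient.map s (by
      rintro _ y ⟨⟨g, hg⟩, rfl⟩
      exact ⟨⟨g, hg⟩, (Equiv.Perm.ext_iff.1 (hc g hg) y).symm⟩))
    (by
      rintro ⟨x⟩
      exact congrArg _ (Equiv.Perm.ext_iff.1 hs x))

theorem orbitPerm_mul_self (s : Equiv.Perm F) (hs : s * s = 1)
    (hc : ∀ g ∈ M.aut, s * g = g * s) : M.orbitPerm s hs hc * M.orbitPerm s hs hc = 1 := by
  ext ⟨x⟩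
  exact congrArg _ (Equiv.Perm.ext_iff.1 hs x)

theorem orbitPerm_mul_pow_eq_one {s t : Equiv.Perm F} (hs : s * s = 1)
    (hsc : ∀ g ∈ M.aut, s * g = g * s) (ht : t * t = 1) (htc : ∀ g ∈ M.aut, t * g = g * t)
    {n : ℕ} (h : (s * t) ^ n = 1) :
    (M.orbitPerm s hs hsc * M.orbitPerm t ht htc) ^ n = 1 := by
  have key : ∀ (k : ℕ) (x : F), ((M.orbitPerm s hs hsc * M.orbitPerm t ht htc) ^ k) ⟦x⟧ =
      ⟦((s * t) ^ k) x⟧ := by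
    intro k x
    induction k with
    | zero => rfl
    | succ k ih => rw [pow_succ', pow_succ', Equiv.Perm.mul_apply, ih]; rfl
  ext ⟨x⟩
  exact (key n x).trans (by rw [h]; rfl)

theorem mk_eq_mk_iff_mem_flagOrbit (x y : F) :
    (⟦x⟧ : MulAction.orbitRel.Quotient M.aut F) = ⟦y⟧ ↔ x ∈ M.flagOrbit y :=
  Quotient.eq

theorem numFlagOrbits_eq_card_quotient :
    M.numFlagOrbits = Nat.card (MulAction.orbitRel.Quotient M.aut F) := by
  refine (Nat.card_eq_of_bijective
    (fun c : MulAction.orbitRel.Quotient M.aut F => (⟨c.orbit, ?_⟩ : Set.range M.flagOrbit))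
    ⟨?_, ?_⟩).symm
  · obtain ⟨x⟩ := c
    exact ⟨x, rfl⟩
  · intro c d h
    exact MulAction.orbitRel.Quotient.orbit_injective (congrArg Subtype.val h)
  · rintro ⟨_, x, rfl⟩
    exact ⟨⟦x⟧, rfl⟩

theorem exists_mem_vertexOf_mk_eq {M : CMap F} (hvt : M.VertexTransitive) (x y : F) :
    ∃ z ∈ M.vertexOf x, (⟦z⟧ : MulAction.orbitRel.Quotient M.aut F) = ⟦y⟧ := by
  obtain ⟨g, hg, h⟩ := hvt y x
  refine ⟨g y, ?_, (M.mk_eq_mk_iff_mem_flagOrbit _ _).2 ⟨⟨g, hg⟩, rfl⟩⟩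
  rw [← h]
  exact MulAction.mem_orbit_self _

end CMap

/-- For `p` positive and congruent to `1` or `5` modulo `6`, every
vertex-transitive equivelar map of Schläfli type `{p, 3}` is regular or chiral. -/
theorem stmt_3 {F : Type} [Fintype F] (p : ℕ) (hp : 0 < p)
    (hmod : p % 6 = 1 ∨ p % 6 = 5) (M : CMap F)
    (heq : M.Equivelar p 3) (hvt : M.VertexTransitive) :
    M.IsRegular ∨ M.IsChiral := by
  have hc : ∀ s ∈ ({M.s0, M.s1, M.s2} : Set (Equiv.Perm F)), ∀ g ∈ M.aut, s * g = g * s :=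
    fun s hs g hg => Subgroup.mem_centralizer_iff.1 hg s hs
  have hc₀ := hc M.s0 (by simp)
  have hc₁ := hc M.s1 (by simp)
  have hc₂ := hc M.s2 (by simp)
  set a₀ := M.orbitPerm M.s0 M.invol0 hc₀ with ha₀
  set a₁ := M.orbitPerm M.s1 M.invol1 hc₁ with ha₁
  set a₂ := M.orbitPerm M.s2 M.invol2 hc₂ with ha₂
  obtain ⟨x₀⟩ := M.nonempty
  have hcomm : M.s0 * M.s2 = M.s2 * M.s0 := by
    rw [eq_comm, ← inv_eq_of_mul_eq_one_left M.invol02, mul_inv_rev,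
      inv_eq_of_mul_eq_one_left M.invol0, inv_eq_of_mul_eq_one_left M.invol2]
  have hp₀₁ : (M.s0 * M.s1) ^ p = 1 := Equiv.ext fun x =>
    pow_mul_apply_eq_self_of_card_orbit M.invol0 M.invol1 M.fpf0 M.fpf1 (heq.1 x)
  have hp₁₂ : (M.s1 * M.s2) ^ 3 = 1 := Equiv.ext fun x =>
    pow_mul_apply_eq_self_of_card_orbit M.invol1 M.invol2 M.fpf1 M.fpf2 (heq.2 x)
  have hcard : Nat.card (MulAction.orbitRel.Quotient M.aut F) ≤ 6 := by
    refine (Nat.card_le_card_of_surjective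
      (fun z : M.vertexOf x₀ => (⟦z.1⟧ : MulAction.orbitRel.Quotient M.aut F)) ?_).trans_eq (heq.2 x₀)
    rintro ⟨y⟩
    obtain ⟨z, hz, h⟩ := CMap.exists_mem_vertexOf_mk_eq hvt x₀ y
    exact ⟨⟨z, hz⟩, h⟩
  have htrans : ∀ S : Set (MulAction.orbitRel.Quotient M.aut F), S.Nonempty →
      (∀ c ∈ S, a₁ c ∈ S) → (∀ c ∈ S, a₂ c ∈ S) → S = Set.univ := by
    rintro S ⟨⟨x⟩, hx⟩ h₁ h₂
    refine Set.eq_univ_of_forall ?_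
    rintro ⟨y⟩
    obtain ⟨_, ⟨⟨g, hg⟩, rfl⟩, h⟩ := CMap.exists_mem_vertexOf_mk_eq hvt x y
    change ⟦y⟧ ∈ S
    rw [← h]
    refine apply_mem_of_mem_closure_of_involutive (S := {z : F | ⟦z⟧ ∈ S}) ?_ ?_ hg hx
    · rintro k (rfl | rfl)
      exacts [M.invol1, M.invol2]
    · rintro k (rfl | rfl) z hz
      exacts [h₁ _ hz, h₂ _ hz]
  obtain ⟨h₀₁, h₁₂⟩ := eq_of_transitive_of_mul_pow_eq_one
    (M.orbitPerm_mul_self _ M.invol0 hc₀) (M.orbitPerm_mul_self _ M.invol1 hc₁)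
    (M.orbitPerm_mul_self _ M.invol2 hc₂)
    (by ext ⟨x⟩; exact congrArg _ (Equiv.Perm.ext_iff.1 hcomm x))
    (M.orbitPerm_mul_pow_eq_one _ hc₁ _ hc₂ hp₁₂) hmod
    (M.orbitPerm_mul_pow_eq_one _ hc₀ _ hc₁ hp₀₁) hcard htrans
  rw [← ha₀, ← ha₁] at h₀₁
  rw [← ha₁, ← ha₂] at h₁₂
  have hinv : ∀ c, a₁ (a₁ c) = c :=
    Equiv.Perm.ext_iff.1 (M.orbitPerm_mul_self _ M.invol1 hc₁)
  by_cases hfix : ∃ c, a₁ c = c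
  · obtain ⟨c, hc⟩ := hfix
    left
    have huniv := htrans {c} ⟨c, rfl⟩ (by simp [hc]) (by simp [← h₁₂, hc])
    rw [CMap.IsRegular, CMap.IsKOrbit, M.numFlagOrbits_eq_card_quotient, ← Set.ncard_univ,
      ← huniv, Set.ncard_singleton]
  · push Not at hfix
    right
    refine ⟨?_, fun x => ?_⟩
    · have huniv := htrans {⟦x₀⟧, a₁ ⟦x₀⟧} ⟨⟦x₀⟧, by simp⟩ (by simp [hinv])
        (by simp [← h₁₂, hinv])
      rw [CMap.IsKOrbit, M.numFlagOrbits_eq_card_quotient, ← Set.ncard_univ,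
        ← huniv, Set.ncard_pair (hfix _).symm]
    · simp only [← M.mk_eq_mk_iff_mem_flagOrbit]
      refine ⟨fun h => hfix ⟦x⟧ ?_, hfix ⟦x⟧, fun h => hfix ⟦x⟧ ?_⟩
      · rw [← h₀₁]; exact h
      · rw [h₁₂]; exact h
end

section
/- Every vertex-transitive equivelar map of Schläfli type {3,7} is regular, chiral, or a 14-orbit map. -/
theorem involution_mul_zpow {G : Type*} [Group G] {b c : G} (hb : b * b = 1) (hc : c * c = 1)
    (i : ℤ) : b * (b * c) ^ i = (b * c) ^ (-i) * b := by
  have h : b * (b * c) * b⁻¹ = (b * c)⁻¹ := by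
    rw [mul_inv_rev, inv_eq_of_mul_eq_one_left hb, inv_eq_of_mul_eq_one_left hc, ← mul_assoc, hb,
      one_mul]
  rw [zpow_neg, ← inv_zpow, ← h, conj_zpow, inv_mul_cancel_right]

/-- Two involutions generate a group consisting of powers of their product and
of such powers times the first involution. -/
theorem exists_zpow_of_mem_closure_involutions {G : Type*} [Group G] {b c : G}
    (hb : b * b = 1) (hc : c * c = 1) {g : G} (hg : g ∈ Subgroup.closure ({b, c} : Set G)) :
    ∃ i : ℤ, g = (b * c) ^ i ∨ g = (b * c) ^ i * b := by
  have hbi : b⁻¹ = b := inv_eq_of_mul_eq_one_left hb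
  have hci : c⁻¹ = c := inv_eq_of_mul_eq_one_left hc
  have hl := involution_mul_zpow hb hc
  have hcb : c = (b * c) ^ (-1 : ℤ) * b := by
    rw [zpow_neg, zpow_one, mul_inv_rev, hbi, hci, mul_assoc, hb, mul_one]
  induction hg using Subgroup.closure_induction with
  | mem x hx =>
    rcases hx with rfl | rfl
    · exact ⟨0, Or.inr (by simp)⟩
    · exact ⟨-1, Or.inr hcb⟩
  | one => exact ⟨0, Or.inl (by simp)⟩
  | mul x y _ _ hx hy =>
    obtain ⟨i, rfl | rfl⟩ := hx <;> obtain ⟨j, rfl | rfl⟩ := hy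
    · exact ⟨i + j, Or.inl (by rw [zpow_add])⟩
    · exact ⟨i + j, Or.inr (by rw [zpow_add, mul_assoc])⟩
    · exact ⟨i - j, Or.inr (by rw [mul_assoc, hl, ← mul_assoc, ← zpow_add, sub_eq_add_neg])⟩
    · refine ⟨i - j, Or.inl ?_⟩
      rw [mul_assoc, ← mul_assoc b, hl, mul_assoc _ b b, hb, mul_one, ← zpow_add, sub_eq_add_neg]
  | inv x _ hx =>
    obtain ⟨i, rfl | rfl⟩ := hx
    · exact ⟨-i, Or.inl (by rw [zpow_neg])⟩
    · exact ⟨i, Or.inr (by rw [mul_inv_rev, hbi, ← zpow_neg, hl, neg_neg])⟩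

section Involutions

variable {X : Type*} {b c : Equiv.Perm X}

theorem involution_apply_zpow_apply (hb : b * b = 1) (hc : c * c = 1) (i : ℤ) (x : X) :
    b (((b * c) ^ i) x) = ((b * c) ^ (-i)) (b x) :=
  congrArg (fun g : Equiv.Perm X => g x) (involution_mul_zpow hb hc i)

/-- An orbit of the group generated by two involutions is the union of an orbit of the
product and of its image under the first involution. -/
theorem orbit_closure_involutions (hb : b * b = 1) (hc : c * c = 1) (x : X) :
    MulAction.orbit (Subgroup.closure ({b, c} : Set (Equiv.Perm X))) x =
      MulAction.orbit (Subgroup.zpowers (b * c)) x ∪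
        b '' MulAction.orbit (Subgroup.zpowers (b * c)) x := by
  have hbm : b ∈ Subgroup.closure ({b, c} : Set (Equiv.Perm X)) :=
    Subgroup.subset_closure (by simp)
  have hcm : c ∈ Subgroup.closure ({b, c} : Set (Equiv.Perm X)) :=
    Subgroup.subset_closure (by simp)
  ext y
  constructor
  · rintro ⟨⟨g, hg⟩, rfl⟩
    obtain ⟨i, rfl | rfl⟩ := exists_zpow_of_mem_closure_involutions hb hc hg
    · exact Or.inl ⟨⟨_, i, rfl⟩, rfl⟩
    · refine Or.inr ⟨((b * c) ^ (-i)) x, ⟨⟨_, -i, rfl⟩, rfl⟩, ?_⟩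
      rw [involution_apply_zpow_apply hb hc, neg_neg]
      rfl
  · rintro (⟨⟨_, i, rfl⟩, rfl⟩ | ⟨_, ⟨⟨_, i, rfl⟩, rfl⟩, rfl⟩)
    · exact ⟨⟨(b * c) ^ i, zpow_mem (mul_mem hbm hcm) i⟩, rfl⟩
    · exact ⟨⟨b * (b * c) ^ i, mul_mem hbm (zpow_mem (mul_mem hbm hcm) i)⟩, rfl⟩

theorem exists_zpow_of_not_disjoint (hb : b * b = 1) (hc : c * c = 1) {x : X}
    (h : ¬ Disjoint (MulAction.orbit (Subgroup.zpowers (b * c)) x)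
      (b '' MulAction.orbit (Subgroup.zpowers (b * c)) x)) :
    ∃ k : ℤ, b x = ((b * c) ^ k) x := by
  obtain ⟨_, ⟨⟨_, i, rfl⟩, rfl⟩, ⟨_, ⟨⟨_, j, rfl⟩, rfl⟩, hij⟩⟩ := Set.not_disjoint_iff.1 h
  change b (((b * c) ^ j) x) = ((b * c) ^ i) x at hij
  rw [involution_apply_zpow_apply hb hc, zpow_neg, Equiv.Perm.inv_eq_iff_eq] at hij
  exact ⟨j + i, by rw [hij, zpow_add]; rfl⟩

theorem disjoint_orbit_of_fixedPointFree (hb : b * b = 1) (hc : c * c = 1)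
    (fb : ∀ x, b x ≠ x) (fc : ∀ x, c x ≠ x) (x : X) :
    Disjoint (MulAction.orbit (Subgroup.zpowers (b * c)) x)
      (b '' MulAction.orbit (Subgroup.zpowers (b * c)) x) := by
  by_contra h
  obtain ⟨k, hk⟩ := exists_zpow_of_not_disjoint hb hc h
  have key : ∀ m : ℤ, b (((b * c) ^ m) x) = ((b * c) ^ (k - m)) x := by
    intro m
    rw [involution_apply_zpow_apply hb hc, hk, ← Equiv.Perm.mul_apply, ← zpow_add]
    congr 2
    ring
  obtain ⟨m, rfl | rfl⟩ := Int.even_or_odd' k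
  · apply fb (((b * c) ^ m) x)
    rw [key]
    congr 2
    ring
  · apply fc (((b * c) ^ m) x)
    have h1 := key (m + 1)
    rw [add_comm m 1, zpow_add, zpow_one, Equiv.Perm.mul_apply, Equiv.Perm.mul_apply,
      ← Equiv.Perm.mul_apply b b, hb, Equiv.Perm.one_apply] at h1
    rw [h1]
    congr 2
    ring

theorem ncard_orbit_zpowers [Finite X] (t : Equiv.Perm X) (x : X) :
    (MulAction.orbit (Subgroup.zpowers t) x).ncard = Function.minimalPeriod t x := by
  have := Fintype.ofFinite (MulAction.orbit (Subgroup.zpowers t) x)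
  rw [← Nat.card_coe_set_eq, Nat.card_eq_fintype_card,
    ← MulAction.minimalPeriod_eq_card (a := t) (b := x)]
  rfl

/-- If fixed-point-free involutions generate an orbit with `2 * p` points, then the `p`-th
power of their product is trivial there. -/
theorem mul_pow_apply_of_card_orbit [Finite X] (hb : b * b = 1) (hc : c * c = 1)
    (fb : ∀ x, b x ≠ x) (fc : ∀ x, c x ≠ x) (x : X) {p : ℕ}
    (hp : Nat.card (MulAction.orbit (Subgroup.closure ({b, c} : Set (Equiv.Perm X))) x) = 2 * p) :
    ((b * c) ^ p) x = x := by
  rw [orbit_closure_involutions hb hc, Nat.card_coe_set_eq,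
    Set.ncard_union_eq (disjoint_orbit_of_fixedPointFree hb hc fb fc x) (Set.toFinite _)
      (Set.toFinite _), Set.ncard_image_of_injective _ b.injective, ncard_orbit_zpowers] at hp
  obtain rfl : Function.minimalPeriod (b * c) x = p := by omega
  rw [Equiv.Perm.coe_pow]
  exact Function.isPeriodicPt_minimalPeriod _ _

end Involutions

/-- The reflections `i ↦ -i` and `i ↦ -i - 1` of the heptagon do not extend to an action of
the Coxeter group `[3, 7]` on its vertices. -/
theorem not_exists_involution_zmod_seven (f : ZMod 7 → ZMod 7) (hf : ∀ i, f (f i) = i)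
    (hc : ∀ i, f (-i - 1) = -f i - 1) (hb : ∀ i, f (-f i) = -f (-i)) : False := by
  have fix_c : ∀ j : ZMod 7, j = -j - 1 → j = 3 := by decide
  have fix_b : ∀ j : ZMod 7, j = -j → j = 0 := by decide
  have h3 : f 3 = 3 := fix_c _ (hc 3)
  have h4 : f 4 = 0 := by
    have := hb 3
    rw [h3] at this
    exact fix_b _ this
  have h0 : f 0 = 4 := by rw [← h4, hf]
  have h2 : f 2 = 6 := by
    have := hc 4
    rw [h4] at this
    exact this
  have h6 : f 6 = 2 := by rw [← h2, hf]
  have h15 : f 1 = -f 5 := by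
    have := hb 2
    rw [h2] at this
    exact this
  have h51 : f 5 = -f 1 - 1 := hc 1
  rw [h51] at h15
  revert h15
  generalize f 1 = j
  revert j
  decide

/-- Transitive actions of a `7`-fold dihedral group which extend to the Coxeter group `[3, 7]`
have degree `1`, `14` or `2`, and in the last case no generator has a fixed point. -/
theorem card_of_coxeter_three_seven {Q : Type*} [Finite Q] [Nonempty Q] {a b c : Equiv.Perm Q}
    (ha : a * a = 1) (hb : b * b = 1) (hc : c * c = 1) (hac : a * c = c * a)
    (hab : (a * b) ^ 3 = 1) (hbc : (b * c) ^ 7 = 1)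
    (htr : ∀ x : Q,
      MulAction.orbit (Subgroup.closure ({b, c} : Set (Equiv.Perm Q))) x = Set.univ) :
    Nat.card Q = 1 ∨ (Nat.card Q = 2 ∧ ∀ q, a q ≠ q ∧ b q ≠ q ∧ c q ≠ q) ∨ Nat.card Q = 14 := by
  have ha' : ∀ q, a (a q) = q := fun q => congrArg (fun g : Equiv.Perm Q => g q) ha
  have hb' : ∀ q, b (b q) = q := fun q => congrArg (fun g : Equiv.Perm Q => g q) hb
  have hc' : ∀ q, c (c q) = q := fun q => congrArg (fun g : Equiv.Perm Q => g q) hc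
  have hac' : ∀ q, a (c q) = c (a q) := fun q => congrArg (fun g : Equiv.Perm Q => g q) hac
  have hbraid : ∀ q, a (b (a q)) = b (a (b q)) := by
    intro q
    have h := congrArg (fun g : Equiv.Perm Q => g (b (a (b q)))) hab
    simp only [pow_succ, pow_zero, one_mul, Equiv.Perm.mul_apply, Equiv.Perm.one_apply, hb',
      ha'] at h
    exact h
  have htr' : ∀ x : Q, MulAction.orbit (Subgroup.zpowers (b * c)) x ∪
      b '' MulAction.orbit (Subgroup.zpowers (b * c)) x = Set.univ := fun x => by
    rw [← htr x, orbit_closure_involutions hb hc]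
  have hper : ∀ q, Function.minimalPeriod (b * c) q = 1 ∨
      Function.minimalPeriod (b * c) q = 7 := by
    intro q
    refine (Nat.dvd_prime (by norm_num : Nat.Prime 7)).1 (Function.IsPeriodicPt.minimalPeriod_dvd ?_)
    rw [Function.IsPeriodicPt, ← Equiv.Perm.coe_pow, hbc]
    rfl
  obtain ⟨q⟩ := ‹Nonempty Q›
  by_cases hd : Disjoint (MulAction.orbit (Subgroup.zpowers (b * c)) q)
      (b '' MulAction.orbit (Subgroup.zpowers (b * c)) q)
  · have hcard := congrArg Set.ncard (htr' q)
    rw [Set.ncard_union_eq hd (Set.toFinite _) (Set.toFinite _),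
      Set.ncard_image_of_injective _ b.injective, ncard_orbit_zpowers, Set.ncard_univ] at hcard
    rcases hper q with h | h
    · refine Or.inr (Or.inl ⟨by omega, ?_⟩)
      have h2 : Nat.card Q = 2 := by omega
      have hbcq : b (c q) = q := Function.minimalPeriod_eq_one_iff_isFixedPt.1 h
      have hcq : c q = b q := by rw [← hb' (c q), hbcq]
      have hbq : b q ≠ q := fun hbq => Set.disjoint_left.1 hd (MulAction.mem_orbit_self q)
        ⟨q, MulAction.mem_orbit_self q, hbq⟩
      have htwo : ∀ y, y = q ∨ y = b q := by
        intro y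
        obtain ⟨z, hz⟩ := Set.ncard_eq_one.1 ((ncard_orbit_zpowers (b * c) q).trans h)
        obtain rfl : q = z := by
          have := MulAction.mem_orbit_self (M := Subgroup.zpowers (b * c)) q
          rwa [hz] at this
        have := (htr' q).ge (Set.mem_univ y)
        rwa [hz, Set.image_singleton] at this
      have haq : a q = b q := by
        refine (htwo (a q)).resolve_left fun h1 => hbq ?_
        have h3 : a (b q) = b q := by
          refine (htwo (a (b q))).resolve_left fun h3 => hbq ?_
          rw [← ha' (b q), h3, h1]
        have h4 := hbraid q
        rwa [h1, h3, hb'] at h4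
      intro x
      rcases htwo x with rfl | rfl
      · exact ⟨haq ▸ hbq, hbq, hcq ▸ hbq⟩
      · refine ⟨?_, by rw [hb']; exact hbq.symm, ?_⟩
        · rw [← haq, ha', haq]; exact hbq.symm
        · rw [← hcq, hc', hcq]; exact hbq.symm
    · exact Or.inr (Or.inr (by omega))
  · obtain ⟨k, hk⟩ := exists_zpow_of_not_disjoint hb hc hd
    have hzp : ∀ y, ∃ i : ℤ, y = ((b * c) ^ i) q := by
      intro y
      rcases (htr' q).ge (Set.mem_univ y) with ⟨⟨_, i, rfl⟩, rfl⟩ | ⟨_, ⟨⟨_, i, rfl⟩, rfl⟩, rfl⟩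
      · exact ⟨i, rfl⟩
      · refine ⟨-i + k, ?_⟩
        rw [zpow_add, Equiv.Perm.mul_apply, ← hk]
        exact involution_apply_zpow_apply hb hc i q
    have hcard : Nat.card Q = Function.minimalPeriod (b * c) q := by
      rw [← ncard_orbit_zpowers, ← Set.ncard_univ]
      congr 1
      ext y
      obtain ⟨i, rfl⟩ := hzp y
      exact ⟨fun _ => ⟨⟨_, i, rfl⟩, rfl⟩, fun _ => trivial⟩
    rcases hper q with h | h
    · exact Or.inl (by omega)
    · exfalso
      have hzmod : ∀ i : ℤ, (b * c) ^ ((i : ZMod 7).val) = (b * c) ^ i := by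
        intro i
        rw [← zpow_natCast, ZMod.val_intCast]
        conv_rhs => rw [← Int.emod_add_mul_ediv i 7, zpow_add, zpow_mul]
        rw [show (b * c) ^ (7 : ℤ) = 1 from hbc]
        simp
      set P : ZMod 7 → Q := fun i => ((b * c) ^ i.val) (((b * c) ^ (4 * k)) q) with hP
      have hPi : ∀ i : ℤ, P i = ((b * c) ^ (i + 4 * k)) q := by
        intro i
        simp only [hP]
        rw [hzmod, zpow_add]
        rfl
      have hPs : Function.Surjective P := by
        intro y
        obtain ⟨i, rfl⟩ := hzp y
        exact ⟨((i - 4 * k : ℤ) : ZMod 7), by rw [hPi]; congr 2; ring⟩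
      have hPb : ∀ i : ZMod 7, b (P i) = P (-i) := by
        intro i
        obtain ⟨i, rfl⟩ := ZMod.intCast_surjective i
        rw [← Int.cast_neg, hPi, hPi, involution_apply_zpow_apply hb hc, hk,
          ← Equiv.Perm.mul_apply, ← zpow_add, ← hzmod, ← hzmod]
        congr 3
        push_cast
        have h7 : (7 : ZMod 7) = 0 := rfl
        linear_combination (-k : ZMod 7) * h7
      have hPt : ∀ i : ZMod 7, (b * c) (P i) = P (i + 1) := by
        intro i
        obtain ⟨i, rfl⟩ := ZMod.intCast_surjective i
        rw [← Int.cast_one, ← Int.cast_add, hPi, hPi, ← Equiv.Perm.mul_apply, ← zpow_one_add]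
        congr 2
        ring
      have hPc : ∀ i : ZMod 7, c (P i) = P (-i - 1) := by
        intro i
        rw [← hb' (c (P i)), ← Equiv.Perm.mul_apply b c, hPt, hPb, neg_add']
      have hPbij : Function.Bijective P := by
        have := Fintype.ofFinite Q
        refine (Fintype.bijective_iff_surjective_and_card P).2 ⟨hPs, ?_⟩
        rw [← Nat.card_eq_fintype_card (α := Q), hcard, h, ZMod.card]
      choose f hf using fun i => hPs (a (P i))
      apply not_exists_involution_zmod_seven f <;> intro i <;> apply hPbij.1
      · rw [hf, hf, ha']
      · rw [hf, ← hPc, ← hPc, hf, hac']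
      · rw [hf, ← hPb, ← hPb, hf, hf, ← hPb, hbraid]

namespace CMap

variable {F : Type} [Fintype F]

/-- The flag orbits of a map. -/
abbrev FlagOrbits (M : CMap F) : Type := MulAction.orbitRel.Quotient M.aut F

theorem numFlagOrbits_eq_card (M : CMap F) : M.numFlagOrbits = Nat.card M.FlagOrbits := by
  refine Nat.card_congr (Equiv.ofBijective
    (fun y => Quotient.mk (MulAction.orbitRel M.aut F) y.2.choose) ⟨?_, ?_⟩)
  · intro y z h
    have h' : M.flagOrbit y.2.choose = M.flagOrbit z.2.choose :=
      MulAction.orbit_eq_iff.2 (Quotient.exact h)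
    exact Subtype.ext (by rw [← y.2.choose_spec, ← z.2.choose_spec, h'])
  · intro q
    induction q using Quotient.inductionOn with | _ x =>
    refine ⟨⟨M.flagOrbit x, x, rfl⟩, Quotient.sound ?_⟩
    exact MulAction.orbit_eq_iff.1 (Exists.choose_spec (⟨x, rfl⟩ : M.flagOrbit x ∈ Set.range _))

/-- The permutation of the flag orbits induced by a permutation of the flags which commutes
with all automorphisms. -/
def onFlagOrbits (M : CMap F) (s : Equiv.Perm F)
    (hs : ∀ g ∈ M.aut, ∀ x, g (s x) = s (g x)) : Equiv.Perm M.FlagOrbits :=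
  Quotient.congr s fun x y => by
    constructor
    · rintro ⟨g, rfl⟩
      exact ⟨g, hs g g.2 y⟩
    · rintro ⟨g, hg⟩
      exact ⟨g, s.injective ((hs g g.2 y).symm.trans hg)⟩

theorem onFlagOrbits_apply_ne_iff (M : CMap F) (s : Equiv.Perm F)
    (hs : ∀ g ∈ M.aut, ∀ x, g (s x) = s (g x)) (x : F) :
    M.onFlagOrbits s hs (Quotient.mk _ x) ≠ Quotient.mk _ x ↔ s x ∉ M.flagOrbit x :=
  not_congr Quotient.eq

end CMap

/-- Every vertex-transitive equivelar map of Schläfli type `{3, 7}`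
is regular, chiral, or a `14`-orbit map. -/
theorem stmt_7 {F : Type} [Fintype F] (M : CMap F)
    (heq : M.Equivelar 3 7) (hvt : M.VertexTransitive) :
    M.IsRegular ∨ M.IsChiral ∨ M.IsKOrbit 14 := by
  have mem_aut : ∀ {s}, s ∈ ({M.s0, M.s1, M.s2} : Set (Equiv.Perm F)) →
      ∀ g ∈ M.aut, ∀ x, g (s x) = s (g x) := fun hs g hg x =>
    (congrArg (fun t : Equiv.Perm F => t x) (Subgroup.mem_centralizer_iff.1 hg _ hs)).symm
  have h0 := mem_aut (s := M.s0) (by simp)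
  have h1 := mem_aut (s := M.s1) (by simp)
  have h2 := mem_aut (s := M.s2) (by simp)
  have hs02 : M.s0 * M.s2 = M.s2 * M.s0 := by
    rw [← inv_eq_of_mul_eq_one_left M.invol02, mul_inv_rev,
      inv_eq_of_mul_eq_one_left M.invol0, inv_eq_of_mul_eq_one_left M.invol2]
  have hface : (M.s0 * M.s1) ^ 3 = 1 := Equiv.ext fun x =>
    mul_pow_apply_of_card_orbit M.invol0 M.invol1 M.fpf0 M.fpf1 x (heq.1 x)
  have hvert : (M.s1 * M.s2) ^ 7 = 1 := Equiv.ext fun x =>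
    mul_pow_apply_of_card_orbit M.invol1 M.invol2 M.fpf1 M.fpf2 x (heq.2 x)
  have lift_eq : ∀ {s t : Equiv.Perm F}, s = t → ∀ x : F,
      (Quotient.mk _ (s x) : M.FlagOrbits) = Quotient.mk _ (t x) := fun h x => by rw [h]
  have : Nonempty M.FlagOrbits := M.nonempty.map (Quotient.mk _)
  have hmain := card_of_coxeter_three_seven (a := M.onFlagOrbits M.s0 h0)
    (b := M.onFlagOrbits M.s1 h1) (c := M.onFlagOrbits M.s2 h2)
    (Equiv.ext (Quotient.ind (lift_eq M.invol0))) (Equiv.ext (Quotient.ind (lift_eq M.invol1)))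
    (Equiv.ext (Quotient.ind (lift_eq M.invol2))) (Equiv.ext (Quotient.ind (lift_eq hs02)))
    (Equiv.ext (Quotient.ind (lift_eq hface))) (Equiv.ext (Quotient.ind (lift_eq hvert))) ?_
  · rw [← M.numFlagOrbits_eq_card] at hmain
    rcases hmain with h | ⟨h, hne⟩ | h
    · exact Or.inl h
    · refine Or.inr (Or.inl ⟨h, fun x => ?_⟩)
      obtain ⟨n0, n1, n2⟩ := hne (Quotient.mk _ x)
      exact ⟨(M.onFlagOrbits_apply_ne_iff _ h0 x).1 n0, (M.onFlagOrbits_apply_ne_iff _ h1 x).1 n1,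
        (M.onFlagOrbits_apply_ne_iff _ h2 x).1 n2⟩
    · exact Or.inr (Or.inr h)
  · intro q
    refine Set.eq_univ_of_forall fun r => ?_
    induction q using Quotient.inductionOn with | _ x =>
    induction r using Quotient.inductionOn with | _ y =>
    obtain ⟨g, hg, hgy⟩ := hvt y x
    have hy : g y ∈ M.vertexOf x := hgy ▸ MulAction.mem_orbit_self (g y)
    have hgq : (Quotient.mk _ (g y) : M.FlagOrbits) = Quotient.mk _ y :=
      Quotient.sound ⟨⟨g, hg⟩, rfl⟩
    rw [← hgq]
    obtain ⟨⟨w, hw⟩, hwx⟩ := hy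
    rw [← hwx]
    clear hwx hgq hgy
    change Quotient.mk _ (w x) ∈ _
    induction hw using Subgroup.closure_induction_left with
    | one => exact MulAction.mem_orbit_self _
    | mul_left s hs w _ ih =>
      rcases hs with rfl | rfl
      · exact MulAction.mem_orbit_of_mem_orbit
          (⟨M.onFlagOrbits M.s1 h1, Subgroup.subset_closure (by simp)⟩ : Subgroup.closure _) ih
      · exact MulAction.mem_orbit_of_mem_orbit
          (⟨M.onFlagOrbits M.s2 h2, Subgroup.subset_closure (by simp)⟩ : Subgroup.closure _) ih
    | inv_mul_cancel s hs w _ ih =>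
      rcases hs with rfl | rfl
      · rw [inv_eq_of_mul_eq_one_left M.invol1]
        exact MulAction.mem_orbit_of_mem_orbit
          (⟨M.onFlagOrbits M.s1 h1, Subgroup.subset_closure (by simp)⟩ : Subgroup.closure _) ih
      · rw [inv_eq_of_mul_eq_one_left M.invol2]
        exact MulAction.mem_orbit_of_mem_orbit
          (⟨M.onFlagOrbits M.s2 h2, Subgroup.subset_closure (by simp)⟩ : Subgroup.closure _) ih
end

section
/- Let p ≥ 5 be a prime and let G be a group of order 6p. Suppose a, b ∈ G are such that a has order 2 and G is generated by {a, b}. Then the element a·b² does not have order 3. -/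
/-- An involution of a group of order `2m` with `m` odd acts on the group by left multiplication
as an odd permutation. -/
theorem sign_toPermHom_eq_neg_one {G : Type*} [Group G] [Fintype G] [DecidableEq G] {m : ℕ}
    (hm : Odd m) (hcard : Fintype.card G = 2 * m) {a : G} (ha : orderOf a = 2) :
    Equiv.Perm.sign (MulAction.toPermHom G G a) = -1 := by
  have hsq : (MulAction.toPermHom G G a) ^ 2 = 1 := by
    rw [← map_pow, ← ha, pow_orderOf_eq_one, map_one]
  have hne : a ≠ 1 := by
    rintro rfl
    simp at ha
  have : IsEmpty (Function.fixedPoints (MulAction.toPermHom G G a)) :=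
    ⟨fun x => hne (mul_eq_right.mp x.2)⟩
  rw [Equiv.Perm.sign_of_pow_two_eq_one hsq, hcard, Fintype.card_eq_zero, Nat.sub_zero,
    Nat.mul_div_cancel_left _ two_pos, hm.neg_one_pow]

/-- If `G` is a group of order `6p` for a prime `p ≥ 5`, generated
by an involution `a` and an element `b`, then `a * b ^ 2` does not have order `3`. -/
theorem stmt_9 (p : ℕ) (hp : p.Prime) (hp5 : 5 ≤ p)
    (G : Type) [Group G] [Fintype G] (hcard : Nat.card G = 6 * p)
    (a b : G) (ha : orderOf a = 2)
    (hgen : Subgroup.closure ({a, b} : Set G) = ⊤) :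
    orderOf (a * b ^ 2) ≠ 3 := by
  classical
  intro h
  have hodd : Odd (3 * p) := (by decide : Odd 3).mul (hp.odd_of_ne_two (by omega))
  have hsign := sign_toPermHom_eq_neg_one hodd
    (by rw [← Nat.card_eq_fintype_card, hcard]; ring) ha
  have hcube := congrArg (fun g => Equiv.Perm.sign (MulAction.toPermHom G G g))
    (h ▸ pow_orderOf_eq_one (a * b ^ 2))
  simp only [map_pow, map_mul, map_one, hsign, Int.units_sq, mul_one] at hcube
  exact absurd hcube (by decide)
end

section
/- Let M be an equivelar map of Schläfli type {p,q} with pq > 2p + 2q, and suppose χ(M) = −m for a positive integer m. Then (pq − 2p − 2q)·|Γ(M)| ≤ 4mpq, with equality if and only if M is regular. -/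
namespace MulAction

/-- If all orbits on a finite type have the same size `c`, then the number of orbits times `c` is
the size of the type. -/
theorem card_range_orbit_mul {G X : Type*} [Group G] [MulAction G X] [Fintype X] {c : ℕ}
    (h : ∀ x : X, Nat.card (orbit G x) = c) :
    Nat.card (Set.range (fun x : X => orbit G x)) * c = Nat.card X := by
  classical
  have hfib (b : Set.range (fun x : X => orbit G x)) :
      Nat.card {x : X // Set.rangeFactorization (fun x : X => orbit G x) x = b} = c := by
    obtain ⟨_, y, rfl⟩ := b
    rw [← h y]
    refine Nat.card_congr (Equiv.subtypeEquivRight fun x => ?_)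
    rw [Subtype.ext_iff]
    exact orbit_eq_iff
  rw [← Nat.card_congr
    (Equiv.sigmaFiberEquiv (Set.rangeFactorization fun x : X => orbit G x)), Nat.card_sigma,
    Finset.sum_congr rfl fun b _ => hfib b]
  rw [Finset.sum_const, smul_eq_mul, Finset.card_univ, ← Nat.card_eq_fintype_card]

end MulAction

namespace CMap

variable {F : Type} [Fintype F] (M : CMap F)

theorem numVertices_mul {p q : ℕ} (h : M.Equivelar p q) :
    M.numVertices * (2 * q) = Nat.card F :=
  MulAction.card_range_orbit_mul h.2

theorem numFaces_mul {p q : ℕ} (h : M.Equivelar p q) :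
    M.numFaces * (2 * p) = Nat.card F :=
  MulAction.card_range_orbit_mul h.1

theorem s0_s0 (x : F) : M.s0 (M.s0 x) = x := by
  simpa using congrArg (fun g : Equiv.Perm F => g x) M.invol0

theorem s2_s2 (x : F) : M.s2 (M.s2 x) = x := by
  simpa using congrArg (fun g : Equiv.Perm F => g x) M.invol2

theorem s2_s0 (x : F) : M.s2 (M.s0 x) = M.s0 (M.s2 x) := by
  have h : M.s0 (M.s2 (M.s0 (M.s2 (M.s2 x)))) = M.s2 x := by
    simpa using congrArg (fun g : Equiv.Perm F => g (M.s2 x)) M.invol02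
  rw [M.s2_s2] at h
  rw [← h, M.s0_s0]

theorem edgeOf_eq (x : F) : M.edgeOf x = {x, M.s0 x, M.s2 x, M.s0 (M.s2 x)} := by
  apply Set.Subset.antisymm
  · rintro _ ⟨⟨g, hg⟩, rfl⟩
    change g x ∈ _
    simp only [Set.mem_insert_iff, Set.mem_singleton_iff]
    induction hg using Subgroup.closure_induction_left with
    | one => simp
    | mul_left a ha b hb ih =>
      rw [Equiv.Perm.mul_apply]
      rcases ha with rfl | rfl <;> rcases ih with h | h | h | h <;>
        simp [h, M.s0_s0, M.s2_s2, M.s2_s0]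
    | inv_mul_cancel a ha b hb ih =>
      rw [Equiv.Perm.mul_apply]
      rcases ha with rfl | rfl
      · rw [inv_eq_of_mul_eq_one_left M.invol0]
        rcases ih with h | h | h | h <;> simp [h, M.s0_s0]
      · rw [inv_eq_of_mul_eq_one_left M.invol2]
        rcases ih with h | h | h | h <;> simp [h, M.s2_s2, M.s2_s0]
  · have h0 : M.s0 ∈ Subgroup.closure ({M.s0, M.s2} : Set (Equiv.Perm F)) :=
      Subgroup.subset_closure (by simp)
    have h2 : M.s2 ∈ Subgroup.closure ({M.s0, M.s2} : Set (Equiv.Perm F)) :=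
      Subgroup.subset_closure (by simp)
    rintro y (rfl | rfl | rfl | rfl)
    · exact MulAction.mem_orbit_self _
    · exact ⟨⟨_, h0⟩, rfl⟩
    · exact ⟨⟨_, h2⟩, rfl⟩
    · exact ⟨⟨_, mul_mem h0 h2⟩, rfl⟩

theorem card_edgeOf (x : F) : Nat.card (M.edgeOf x) = 4 := by
  rw [edgeOf_eq, Nat.card_coe_set_eq]
  have h02 : M.s0 x ≠ M.s2 x := fun h => M.fpf02 x (by rw [← h, M.s0_s0])
  have h1 : M.s0 x ≠ M.s0 (M.s2 x) := fun h => M.fpf2 x (M.s0.injective h).symm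
  rw [Set.ncard_insert_of_notMem, Set.ncard_insert_of_notMem, Set.ncard_pair]
  · exact (M.fpf0 _).symm
  · simp [h02, h1]
  · simp [(M.fpf0 x).symm, (M.fpf2 x).symm, (M.fpf02 x).symm]

theorem numEdges_mul : M.numEdges * 4 = Nat.card F :=
  MulAction.card_range_orbit_mul M.card_edgeOf

/-- An automorphism commutes with the whole monodromy group. -/
theorem aut_apply_comm {a g : Equiv.Perm F} (ha : a ∈ M.aut)
    (hg : g ∈ Subgroup.closure ({M.s0, M.s1, M.s2} : Set (Equiv.Perm F))) (x : F) :
    a (g x) = g (a x) := by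
  rw [aut, ← Subgroup.centralizer_closure] at ha
  exact congrArg (fun h : Equiv.Perm F => h x) (Subgroup.mem_centralizer_iff.1 ha g hg).symm

/-- Automorphisms act semiregularly on flags, so all flag orbits have size `|Γ(M)|`. -/
theorem card_flagOrbit (x : F) : Nat.card (M.flagOrbit x) = Nat.card M.aut := by
  refine (Nat.card_range_of_injective (f := fun a : M.aut => a • x) fun a b hab => ?_)
  ext y
  obtain ⟨g, hg, rfl⟩ := M.conn x y
  rw [M.aut_apply_comm a.2 hg, M.aut_apply_comm b.2 hg]
  exact congrArg g hab

theorem numFlagOrbits_mul : M.numFlagOrbits * Nat.card M.aut = Nat.card F :=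
  MulAction.card_range_orbit_mul M.card_flagOrbit

theorem card_aut_le : Nat.card M.aut ≤ Nat.card F := by
  obtain ⟨x⟩ := M.nonempty
  rw [← M.card_flagOrbit x]
  exact Nat.card_le_card_of_injective _ Subtype.val_injective

theorem isRegular_iff_card_aut : M.IsRegular ↔ Nat.card M.aut = Nat.card F := by
  rw [IsRegular, IsKOrbit, ← M.numFlagOrbits_mul]
  constructor
  · intro h
    rw [h, one_mul]
  · intro h
    exact Nat.eq_of_mul_eq_mul_right Nat.card_pos (by rw [one_mul, ← h])

/-- The Euler characteristic of an equivelar map, in terms of its number of flags. -/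
theorem euler_mul {p q : ℕ} (h : M.Equivelar p q) :
    4 * p * q * M.euler = -(((p : ℤ) * q - 2 * p - 2 * q) * Nat.card F) := by
  have hv : (M.numVertices : ℤ) * (2 * q) = Nat.card F := mod_cast M.numVertices_mul h
  have hf : (M.numFaces : ℤ) * (2 * p) = Nat.card F := mod_cast M.numFaces_mul h
  have he : (M.numEdges : ℤ) * 4 = Nat.card F := mod_cast M.numEdges_mul
  rw [euler]
  linear_combination 2 * (p : ℤ) * hv + 2 * (q : ℤ) * hf - (p : ℤ) * q * he

end CMap

/-- For an equivelar map of Schläfli type `{p, q}` with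
`pq > 2p + 2q` and Euler characteristic `-m`, `m > 0`, one has
`(pq - 2p - 2q)·|Γ(M)| ≤ 4mpq`, with equality iff `M` is regular. -/
theorem stmt_13 {F : Type} [Fintype F] (M : CMap F) (p q m : ℕ)
    (heq : M.Equivelar p q) (hpq : 2 * p + 2 * q < p * q)
    (hm : 0 < m) (hchi : M.euler = -(m : ℤ)) :
    ((p : ℤ) * q - 2 * p - 2 * q) * (Nat.card M.aut : ℤ) ≤ 4 * m * p * q ∧
    (((p : ℤ) * q - 2 * p - 2 * q) * (Nat.card M.aut : ℤ) = 4 * m * p * q ↔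
      M.IsRegular) := by
  have hd : (0 : ℤ) < (p : ℤ) * q - 2 * p - 2 * q := by
    have : (2 * p + 2 * q : ℤ) < p * q := mod_cast hpq
    linarith
  have hF : 4 * (m : ℤ) * p * q = ((p : ℤ) * q - 2 * p - 2 * q) * Nat.card F := by
    have h := M.euler_mul heq
    rw [hchi] at h
    linear_combination -h
  rw [hF, M.isRegular_iff_card_aut]
  refine ⟨mul_le_mul_of_nonneg_left (mod_cast M.card_aut_le) hd.le, ?_⟩
  rw [mul_right_inj' hd.ne', Nat.cast_inj]
end
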